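/- Let ν = (n₁,…,n_s) be a sequence of positive integers with n = n₁ + ⋯ + n_s, let I(ν) be the set of ν-block-increasing permutations of {1,…,n}, let ℓ denote the inversion number, and let ν_o be the number of indices j with n_j odd. Set ℓ_e = #{w ∈ I(ν) : ℓ(w) even} and ℓ_o = #{w ∈ I(ν) : ℓ(w) odd}. If ν_o ≥ 2 then ℓ_e = ℓ_o = (1/2)·n!/(n₁!⋯n_s!). If ν_o ≤ 1 then ℓ_e = (n!/(n₁!⋯n_s!) + ⌊n/2⌋!/(⌊n₁/2⌋!⋯⌊n_s/2⌋!))/2 and ℓ_o = (n!/(n₁!⋯n_s!) − ⌊n/2⌋!/(⌊n₁/2⌋!⋯⌊n_s/2⌋!))/2. -/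

import Mathlib

/-- `blockStart ν j = n₁ + ⋯ + n_j` is the `j`-th partial sum of the block sizes `ν`. -/
def blockStart (ν : ℕ → ℕ) (j : ℕ) : ℕ := ∑ i ∈ Finset.range j, ν i

/-- A permutation `w` of `{0, …, n-1}` is `ν`-block-increasing if it is strictly increasing
on each block `{blockStart ν j, …, blockStart ν (j+1) - 1}`, `0 ≤ j < s`. -/
def BlockIncreasing (s n : ℕ) (ν : ℕ → ℕ) (w : Equiv.Perm (Fin n)) : Prop :=
  ∀ j < s, ∀ t r : Fin n, blockStart ν j ≤ (t : ℕ) → (t : ℕ) < (r : ℕ) →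
    (r : ℕ) < blockStart ν (j + 1) → (w t : ℕ) < (w r : ℕ)

/-- The inversion number `ℓ(w) = #{(t,r) : t < r, w(t) > w(r)}` of a permutation `w`. -/
def inversions (n : ℕ) (w : Equiv.Perm (Fin n)) : ℕ :=
  (Finset.univ.filter fun p : Fin n × Fin n => p.1 < p.2 ∧ w p.2 < w p.1).card

open Polynomial in
/-- The `q`-integer `[k] = 1 + q + ⋯ + q^(k-1)`, as a polynomial in `q`. -/
noncomputable def qInt (k : ℕ) : ℤ[X] := ∑ i ∈ Finset.range k, X ^ i

open Polynomial in
/-- The `q`-factorial `[n]! = [1][2]⋯[n]`. -/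
noncomputable def qFactorial (n : ℕ) : ℤ[X] := ∏ k ∈ Finset.range n, qInt (k + 1)

open Polynomial Classical in
/-- The inversion generating polynomial of the `ν`-block-increasing permutations. -/
noncomputable def inversionPoly (s n : ℕ) (ν : ℕ → ℕ) : ℤ[X] :=
  ∑ w : Equiv.Perm (Fin n), if BlockIncreasing s n ν w then X ^ inversions n w else 0

/-- The permutation sending `p` to `0` and whose remaining values are ordered as those of `e`. -/
def insertZero {n : ℕ} (p : Fin (n + 1)) (e : Equiv.Perm (Fin n)) : Equiv.Perm (Fin (n + 1)) :=
  ((finSuccEquiv' p).trans e.optionCongr).trans (finSuccEquiv' 0).symm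

@[simp] lemma insertZero_self {n : ℕ} (p : Fin (n + 1)) (e : Equiv.Perm (Fin n)) :
    insertZero p e p = 0 := by
  simp [insertZero]

@[simp] lemma insertZero_succAbove {n : ℕ} (p : Fin (n + 1)) (e : Equiv.Perm (Fin n))
    (i : Fin n) : insertZero p e (p.succAbove i) = (e i).succ := by
  simp [insertZero]

lemma insertZero_bijective (n : ℕ) : Function.Bijective
    (fun x : Fin (n + 1) × Equiv.Perm (Fin n) => insertZero x.1 x.2) := by
  rw [Fintype.bijective_iff_injective_and_card]
  refine ⟨?_, by simp [Fintype.card_perm, Nat.factorial_succ]⟩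
  rintro ⟨p, e⟩ ⟨p', e'⟩ h
  simp only at h
  obtain rfl : p = p' := by
    apply (insertZero p' e').injective
    rw [← h, insertZero_self, h, insertZero_self]
  congr 1
  ext i
  have := congrArg (fun w : Equiv.Perm (Fin (n + 1)) => w (p.succAbove i)) h
  simp only [insertZero_succAbove, Fin.succ_inj] at this
  rw [this]

lemma sum_perm_succ {M : Type*} [AddCommMonoid M] {n : ℕ}
    (f : Equiv.Perm (Fin (n + 1)) → M) :
    ∑ w, f w = ∑ p, ∑ e, f (insertZero p e) := by
  rw [← Fintype.sum_prod_type']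
  exact ((insertZero_bijective n).sum_comp f).symm

lemma inversions_eq_sum (n : ℕ) (w : Equiv.Perm (Fin n)) :
    inversions n w = ∑ i, ∑ j, if i < j ∧ w j < w i then 1 else 0 := by
  rw [inversions, Finset.card_filter, Fintype.sum_prod_type]

lemma inversions_insertZero {n : ℕ} (p : Fin (n + 1)) (e : Equiv.Perm (Fin n)) :
    inversions (n + 1) (insertZero p e) = p + inversions n e := by
  have hcard : (∑ i : Fin n, if p.succAbove i < p then 1 else 0) = (p : ℕ) := by
    simp only [Fin.succAbove_lt_iff_castSucc_lt]
    simp only [Fin.lt_def, Fin.val_castSucc]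
    rw [Fin.sum_univ_eq_sum_range (fun i => if i < (p : ℕ) then 1 else 0) n,
      ← Finset.card_filter]
    have : (Finset.range n).filter (· < (p : ℕ)) = Finset.range p := by
      ext i
      simp only [Finset.mem_filter, Finset.mem_range]
      omega
    rw [this, Finset.card_range]
  rw [inversions_eq_sum, inversions_eq_sum, Fin.sum_univ_succAbove _ p]
  simp only [Fin.sum_univ_succAbove _ p, insertZero_self, insertZero_succAbove,
    Fin.succAbove_lt_succAbove_iff, Fin.succ_lt_succ_iff, Fin.not_lt_zero, and_false,
    Fin.succ_pos, and_true, Finset.sum_add_distrib, hcard]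
  simp

lemma blockStart_succ (ν : ℕ → ℕ) (j : ℕ) :
    blockStart ν (j + 1) = blockStart ν j + ν j :=
  Finset.sum_range_succ _ _

lemma blockStart_mono (ν : ℕ → ℕ) : Monotone (blockStart ν) :=
  monotone_nat_of_le_succ fun j => by rw [blockStart_succ]; omega

lemma blockStart_update_of_le {ν : ℕ → ℕ} {j k : ℕ} (h : k ≤ j) (a : ℕ) :
    blockStart (Function.update ν j a) k = blockStart ν k := by
  refine Finset.sum_congr rfl fun i hi => Function.update_of_ne ?_ _ _
  have := Finset.mem_range.1 hi
  omega

lemma blockStart_update_of_lt {ν : ℕ → ℕ} {j k : ℕ} (h : j < k) (hj : 0 < ν j) :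
    blockStart (Function.update ν j (ν j - 1)) k + 1 = blockStart ν k := by
  induction k, h using Nat.le_induction with
  | base =>
    rw [Nat.succ_eq_add_one, blockStart_succ, blockStart_succ, blockStart_update_of_le le_rfl,
      Function.update_self]
    omega
  | succ k hk ih =>
    rw [blockStart_succ, blockStart_succ, Function.update_of_ne (by omega), ← ih]
    omega

lemma sum_range_blockStart {M : Type*} [AddCommMonoid M] (ν : ℕ → ℕ) (F : ℕ → M) (s : ℕ) :
    ∑ p ∈ Finset.range (blockStart ν s), F p =
      ∑ j ∈ Finset.range s, ∑ i ∈ Finset.range (ν j), F (blockStart ν j + i) := by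
  induction s with
  | zero => simp [blockStart]
  | succ s ih => rw [blockStart_succ, Finset.sum_range_add, ih, Finset.sum_range_succ]

lemma not_blockIncreasing_insertZero {s n j i : ℕ} {ν : ℕ → ℕ} (hj : j < s) (hi : 0 < i)
    (hiν : i < ν j) {p : Fin (n + 1)} (hp : (p : ℕ) = blockStart ν j + i)
    (e : Equiv.Perm (Fin n)) : ¬ BlockIncreasing s (n + 1) ν (insertZero p e) := by
  intro h
  have := h j hj ⟨blockStart ν j, by omega⟩ p le_rfl (by simp only; omega)
    (by rw [blockStart_succ]; omega)
  simp at this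

lemma val_succAbove {n : ℕ} (p : Fin (n + 1)) (i : Fin n) :
    ((i : ℕ) < p ∧ (p.succAbove i : ℕ) = i) ∨ ((p : ℕ) ≤ i ∧ (p.succAbove i : ℕ) = i + 1) := by
  rcases lt_or_ge (i : ℕ) p with h | h
  · exact .inl ⟨h, by rw [Fin.succAbove_of_castSucc_lt _ _ (by simpa [Fin.lt_def] using h)]; simp⟩
  · exact .inr ⟨h, by rw [Fin.succAbove_of_le_castSucc _ _ (by simpa [Fin.le_def] using h)]; simp⟩

lemma blockIncreasing_insertZero_iff {s n j : ℕ} {ν : ℕ → ℕ} (hνj : 0 < ν j)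
    {p : Fin (n + 1)} (hp : (p : ℕ) = blockStart ν j) (e : Equiv.Perm (Fin n)) :
    BlockIncreasing s (n + 1) ν (insertZero p e) ↔
      BlockIncreasing s n (Function.update ν j (ν j - 1)) e := by
  have key (k : ℕ) (t r : Fin n) :
      (blockStart (Function.update ν j (ν j - 1)) k ≤ t ∧ (t : ℕ) < r ∧
        (r : ℕ) < blockStart (Function.update ν j (ν j - 1)) (k + 1)) ↔
      (blockStart ν k ≤ p.succAbove t ∧ (p.succAbove t : ℕ) < p.succAbove r ∧
        (p.succAbove r : ℕ) < blockStart ν (k + 1)) := by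
    have ht := val_succAbove p t
    have hr := val_succAbove p r
    rcases lt_trichotomy k j with h | rfl | h
    · have := blockStart_mono ν (show k + 1 ≤ j from h)
      rw [blockStart_update_of_le h.le, blockStart_update_of_le (show k + 1 ≤ j from h)]
      omega
    · have := blockStart_update_of_lt (Nat.lt_succ_self k) hνj
      rw [Nat.succ_eq_add_one] at this
      rw [blockStart_update_of_le le_rfl]
      omega
    · have h1 := blockStart_update_of_lt h hνj
      have h2 := blockStart_update_of_lt (h.trans (Nat.lt_succ_self k)) hνj
      rw [Nat.succ_eq_add_one] at h2
      have h3 := blockStart_mono ν (show j + 1 ≤ k from h)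
      rw [blockStart_succ] at h3
      omega
  constructor
  · intro h k hk t r h1 h2 h3
    obtain ⟨g1, g2, g3⟩ := (key k t r).1 ⟨h1, h2, h3⟩
    simpa using h k hk _ _ g1 g2 g3
  · intro h k hk t r h1 h2 h3
    rcases Fin.eq_self_or_eq_succAbove p r with rfl | ⟨r, rfl⟩
    · exfalso
      rcases lt_or_ge k j with hkj | hkj
      · have := blockStart_mono ν (show k + 1 ≤ j from hkj)
        omega
      · have := blockStart_mono ν hkj
        omega
    rcases Fin.eq_self_or_eq_succAbove p t with rfl | ⟨t, rfl⟩
    · simp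
    · obtain ⟨g1, g2, g3⟩ := (key k t r).2 ⟨h1, h2, h3⟩
      simpa using h k hk _ _ g1 g2 g3

lemma qFactorial_succ (n : ℕ) : qFactorial (n + 1) = qFactorial n * qInt (n + 1) :=
  Finset.prod_range_succ _ _

open Polynomial in
lemma qInt_blockStart (ν : ℕ → ℕ) (s : ℕ) :
    qInt (blockStart ν s) = ∑ j ∈ Finset.range s, X ^ blockStart ν j * qInt (ν j) := by
  rw [qInt, sum_range_blockStart]
  simp only [qInt, pow_add, Finset.mul_sum]

open Polynomial in
lemma inversionPoly_succ {s n : ℕ} {ν : ℕ → ℕ} (hn : n + 1 = blockStart ν s) :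
    inversionPoly s (n + 1) ν = ∑ j ∈ Finset.range s, if 0 < ν j then
      X ^ blockStart ν j * inversionPoly s n (Function.update ν j (ν j - 1)) else 0 := by
  classical
  let F (p : ℕ) : ℤ[X] := ∑ e : Equiv.Perm (Fin n),
    if BlockIncreasing s (n + 1) ν (insertZero (Fin.ofNat (n + 1) p) e) then
      X ^ inversions (n + 1) (insertZero (Fin.ofNat (n + 1) p) e) else 0
  have hF : inversionPoly s (n + 1) ν = ∑ p ∈ Finset.range (n + 1), F p := by
    rw [inversionPoly, sum_perm_succ, ← Fin.sum_univ_eq_sum_range]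
    refine Finset.sum_congr rfl fun p _ => ?_
    simp only [F, Fin.ofNat_eq_cast, Fin.cast_val_eq_self]
  rw [hF, hn, sum_range_blockStart]
  refine Finset.sum_congr rfl fun j hj => ?_
  have hjs := Finset.mem_range.1 hj
  have hlt (i : ℕ) (hi : i < ν j) :
      ((Fin.ofNat (n + 1) (blockStart ν j + i) : Fin (n + 1)) : ℕ) = blockStart ν j + i := by
    have := blockStart_mono ν (show j + 1 ≤ s from hjs)
    rw [blockStart_succ] at this
    exact Nat.mod_eq_of_lt (by omega)
  split_ifs with hν
  · rw [Finset.sum_eq_single_of_mem 0 (Finset.mem_range.2 hν)]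
    · have h0 := hlt 0 hν
      simp only [F, inversionPoly, Finset.mul_sum]
      refine Finset.sum_congr rfl fun e _ => ?_
      rw [inversions_insertZero, h0, if_congr (blockIncreasing_insertZero_iff hν h0 e) rfl rfl]
      simp only [mul_ite, mul_zero, add_zero, pow_add]
    · intro i hi hi0
      have hi := Finset.mem_range.1 hi
      exact Finset.sum_eq_zero fun e _ => if_neg
        (not_blockIncreasing_insertZero hjs (Nat.pos_of_ne_zero hi0) hi (hlt i hi) e)
  · simp [Nat.eq_zero_of_not_pos hν]

/-- The inversion generating polynomial is the `q`-multinomial coefficient. -/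
theorem inversionPoly_mul_prod_qFactorial {s n : ℕ} {ν : ℕ → ℕ} (hn : n = blockStart ν s) :
    inversionPoly s n ν * ∏ j ∈ Finset.range s, qFactorial (ν j) = qFactorial n := by
  induction n generalizing ν with
  | zero =>
    have h0 : ∀ j ∈ Finset.range s, ν j = 0 := by
      rw [← Finset.sum_eq_zero_iff]
      exact hn.symm
    rw [Finset.prod_eq_one fun j hj => by rw [h0 j hj]; simp [qFactorial]]
    simp [inversionPoly, qFactorial, BlockIncreasing, inversions]
  | succ n ih =>
    rw [inversionPoly_succ hn, Finset.sum_mul, qFactorial_succ, hn, qInt_blockStart,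
      Finset.mul_sum]
    refine Finset.sum_congr rfl fun j hj => ?_
    split_ifs with hν
    · have hjs := Finset.mem_range.1 hj
      have hstart := blockStart_update_of_lt hjs hν
      rw [← ih (ν := Function.update ν j (ν j - 1)) (by omega),
        ← Finset.mul_prod_erase _ _ hj, ← Finset.mul_prod_erase _ _ hj, Function.update_self]
      have hprod : ∏ i ∈ (Finset.range s).erase j,
          qFactorial (Function.update ν j (ν j - 1) i) =
          ∏ i ∈ (Finset.range s).erase j, qFactorial (ν i) :=
        Finset.prod_congr rfl fun i hi => by
          rw [Function.update_of_ne (Finset.ne_of_mem_erase hi)]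
      have hfac : qFactorial (ν j) = qFactorial (ν j - 1) * qInt (ν j) := by
        conv_lhs => rw [← Nat.sub_add_cancel hν, qFactorial_succ, Nat.sub_add_cancel hν]
      rw [hprod, hfac]
      ring
    · simp [Nat.eq_zero_of_not_pos hν, qInt]

lemma eval_one_qFactorial (n : ℕ) : (qFactorial n).eval 1 = n.factorial := by
  induction n with
  | zero => simp [qFactorial]
  | succ n ih =>
    rw [qFactorial_succ, Polynomial.eval_mul, ih, Nat.factorial_succ]
    simp [qInt, Polynomial.eval_finsetSum, mul_comm]

open Polynomial in
lemma qInt_two_mul (m : ℕ) : qInt (2 * m) = (1 + X) * ∑ i ∈ Finset.range m, X ^ (2 * i) := by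
  induction m with
  | zero => simp [qInt]
  | succ m ih =>
    rw [qInt] at ih
    rw [qInt, show 2 * (m + 1) = 2 * m + 1 + 1 by ring, Finset.sum_range_succ,
      Finset.sum_range_succ, ih, Finset.sum_range_succ]
    ring

open Polynomial in
lemma exists_qFactorial_eq (n : ℕ) :
    ∃ P : ℤ[X], qFactorial n = (1 + X) ^ (n / 2) * P ∧ P.eval (-1) = (n / 2).factorial := by
  induction n with
  | zero => exact ⟨1, by simp [qFactorial]⟩
  | succ n ih =>
    obtain ⟨P, hP, hP'⟩ := ih
    rcases Nat.even_or_odd' n with ⟨m, rfl | rfl⟩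
    · refine ⟨P * qInt (2 * m + 1), ?_, ?_⟩
      · rw [qFactorial_succ, hP, show (2 * m + 1) / 2 = 2 * m / 2 by omega, mul_assoc]
      · rw [show (2 * m + 1) / 2 = 2 * m / 2 by omega, eval_mul, hP', qInt,
          Finset.sum_range_succ, ← qInt, qInt_two_mul]
        simp
    · refine ⟨P * ∑ i ∈ Finset.range (m + 1), X ^ (2 * i), ?_, ?_⟩
      · rw [qFactorial_succ, hP, show 2 * m + 1 + 1 = 2 * (m + 1) by ring, qInt_two_mul,
          show 2 * (m + 1) / 2 = (2 * m + 1) / 2 + 1 by omega]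
        ring
      · rw [eval_mul, hP', show (2 * m + 1 + 1) / 2 = m + 1 by omega,
          show (2 * m + 1) / 2 = m by omega, Nat.factorial_succ]
        simp only [eval_finsetSum, pow_mul, eval_pow, eval_X]
        simp [mul_comm]

lemma eval_one_inversionPoly {s n : ℕ} {ν : ℕ → ℕ} (hn : n = blockStart ν s) :
    (inversionPoly s n ν).eval 1 = Nat.multinomial (Finset.range s) ν := by
  have h := congrArg (Polynomial.eval 1) (inversionPoly_mul_prod_qFactorial hn)
  have hm := Nat.multinomial_spec (Finset.range s) ν
  rw [← blockStart, ← hn] at hm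
  rw [Polynomial.eval_mul, Polynomial.eval_prod, eval_one_qFactorial, ← hm] at h
  simp only [eval_one_qFactorial] at h
  push_cast at h
  rw [mul_comm] at h
  exact mul_left_cancel₀
    (Finset.prod_ne_zero_iff.2 fun j _ => by exact_mod_cast (ν j).factorial_ne_zero) h

lemma blockStart_div_two (ν : ℕ → ℕ) (s : ℕ) :
    blockStart ν s / 2 = ∑ j ∈ Finset.range s, ν j / 2 +
      ((Finset.range s).filter fun j => Odd (ν j)).card / 2 := by
  have h : blockStart ν s = 2 * ∑ j ∈ Finset.range s, ν j / 2 +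
      ((Finset.range s).filter fun j => Odd (ν j)).card := by
    rw [blockStart, Finset.card_filter, Finset.mul_sum, ← Finset.sum_add_distrib]
    refine Finset.sum_congr rfl fun j _ => ?_
    split_ifs with h
    · rw [Nat.odd_iff] at h
      omega
    · rw [Nat.not_odd_iff] at h
      omega
  omega

open Polynomial in
lemma eval_neg_one_inversionPoly {s n : ℕ} {ν : ℕ → ℕ} (hn : n = blockStart ν s) :
    (inversionPoly s n ν).eval (-1) * ∏ j ∈ Finset.range s, ((ν j / 2).factorial : ℤ) =
      0 ^ (((Finset.range s).filter fun j => Odd (ν j)).card / 2) * (n / 2).factorial := by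
  choose P hP hP' using exists_qFactorial_eq
  have h := inversionPoly_mul_prod_qFactorial hn
  simp only [hP, Finset.prod_mul_distrib, Finset.prod_pow_eq_pow_sum] at h
  have hne : (1 + X : ℤ[X]) ≠ 0 := by
    rw [add_comm]
    exact (monic_X_add_C (1 : ℤ)).ne_zero
  have hcancel : inversionPoly s n ν * ∏ j ∈ Finset.range s, P (ν j) =
      (1 + X) ^ (((Finset.range s).filter fun j => Odd (ν j)).card / 2) * P n := by
    apply mul_left_cancel₀ (pow_ne_zero (∑ j ∈ Finset.range s, ν j / 2) hne)
    rw [← mul_assoc _ _ (P n), ← pow_add, ← blockStart_div_two, ← hn, ← h]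
    ring
  have := congrArg (eval (-1)) hcancel
  simpa [eval_prod, hP'] using this

open Classical in
lemma eval_inversionPoly (s n : ℕ) (ν : ℕ → ℕ) (q : ℤ) :
    (inversionPoly s n ν).eval q = ∑ w : Equiv.Perm (Fin n),
      if BlockIncreasing s n ν w then q ^ inversions n w else 0 := by
  rw [inversionPoly, Polynomial.eval_finsetSum]
  exact Finset.sum_congr rfl fun w _ => by split_ifs <;> simp

lemma card_even_add_card_odd_inversions (s n : ℕ) (ν : ℕ → ℕ) :
    (Nat.card {w : Equiv.Perm (Fin n) // BlockIncreasing s n ν w ∧ Even (inversions n w)} : ℤ) +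
      Nat.card {w : Equiv.Perm (Fin n) // BlockIncreasing s n ν w ∧ Odd (inversions n w)} =
      (inversionPoly s n ν).eval 1 := by
  classical
  rw [eval_inversionPoly, Nat.card_eq_fintype_card, Nat.card_eq_fintype_card,
    Fintype.card_subtype, Fintype.card_subtype, Finset.card_filter, Finset.card_filter]
  push_cast
  rw [← Finset.sum_add_distrib]
  refine Finset.sum_congr rfl fun w _ => ?_
  by_cases hw : BlockIncreasing s n ν w <;>
    rcases Nat.even_or_odd (inversions n w) with h | h <;>
    simp [hw, h, Nat.not_even_iff_odd, Nat.not_odd_iff_even]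

lemma card_even_sub_card_odd_inversions (s n : ℕ) (ν : ℕ → ℕ) :
    (Nat.card {w : Equiv.Perm (Fin n) // BlockIncreasing s n ν w ∧ Even (inversions n w)} : ℤ) -
      Nat.card {w : Equiv.Perm (Fin n) // BlockIncreasing s n ν w ∧ Odd (inversions n w)} =
      (inversionPoly s n ν).eval (-1) := by
  classical
  rw [eval_inversionPoly, Nat.card_eq_fintype_card, Nat.card_eq_fintype_card,
    Fintype.card_subtype, Fintype.card_subtype, Finset.card_filter, Finset.card_filter]
  push_cast
  rw [← Finset.sum_sub_distrib]
  refine Finset.sum_congr rfl fun w _ => ?_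
  by_cases hw : BlockIncreasing s n ν w <;>
    rcases Nat.even_or_odd (inversions n w) with h | h <;>
    simp [hw, h, h.neg_one_pow, Nat.not_even_iff_odd, Nat.not_odd_iff_even]

/-- Let `ν = (n₁, …, n_s)` be a sequence of positive integers with
`n = n₁ + ⋯ + n_s`, let `I(ν)` be the set of ν-block-increasing permutations, `ℓ` the
inversion number, `ν_o` the number of odd `n_j`, and set
`ℓ_e = #{w ∈ I(ν) : ℓ(w) even}`, `ℓ_o = #{w ∈ I(ν) : ℓ(w) odd}`.  If `ν_o ≥ 2` then
`ℓ_e = ℓ_o = (1/2)·n!/(n₁!⋯n_s!)`.  If `ν_o ≤ 1` then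
`ℓ_e = (n!/(n₁!⋯n_s!) + ⌊n/2⌋!/(⌊n₁/2⌋!⋯⌊n_s/2⌋!))/2` and
`ℓ_o = (n!/(n₁!⋯n_s!) − ⌊n/2⌋!/(⌊n₁/2⌋!⋯⌊n_s/2⌋!))/2`. -/
theorem card_blockIncreasing_even_odd_inversions
    (s n : ℕ) (ν : ℕ → ℕ) (hpos : ∀ j < s, 0 < ν j)
    (hn : n = blockStart ν s)
    (νo : ℕ) (hνo : νo = ((Finset.range s).filter fun j => Odd (ν j)).card)
    (le lo : ℕ)
    (hle : le = Nat.card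
      {w : Equiv.Perm (Fin n) // BlockIncreasing s n ν w ∧ Even (inversions n w)})
    (hlo : lo = Nat.card
      {w : Equiv.Perm (Fin n) // BlockIncreasing s n ν w ∧ Odd (inversions n w)}) :
    (2 ≤ νo →
      2 * le = Nat.multinomial (Finset.range s) ν ∧
      2 * lo = Nat.multinomial (Finset.range s) ν) ∧
    (νo ≤ 1 →
      (2 * le : ℤ) = (Nat.multinomial (Finset.range s) ν : ℤ) +
        ((Nat.factorial (n / 2) / ∏ j ∈ Finset.range s, Nat.factorial (ν j / 2) : ℕ) : ℤ) ∧
      (2 * lo : ℤ) = (Nat.multinomial (Finset.range s) ν : ℤ) -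
        ((Nat.factorial (n / 2) / ∏ j ∈ Finset.range s, Nat.factorial (ν j / 2) : ℕ) : ℤ)) := by
  have hadd := card_even_add_card_odd_inversions s n ν
  have hsub := card_even_sub_card_odd_inversions s n ν
  have heval := eval_neg_one_inversionPoly hn
  rw [eval_one_inversionPoly hn] at hadd
  rw [← hle, ← hlo] at hadd hsub
  rw [← hνo] at heval
  have hprod : ∏ j ∈ Finset.range s, ((ν j / 2).factorial : ℤ) ≠ 0 :=
    Finset.prod_ne_zero_iff.2 fun j _ => by exact_mod_cast (ν j / 2).factorial_ne_zero
  constructor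
  · intro h2
    rw [zero_pow (by omega), zero_mul] at heval
    rw [(mul_eq_zero.1 heval).resolve_right hprod] at hsub
    constructor <;> omega
  · intro h1
    rw [Nat.div_eq_of_lt (show νo < 2 by omega), pow_zero, one_mul] at heval
    have hdiv : (((n / 2).factorial / ∏ j ∈ Finset.range s, (ν j / 2).factorial : ℕ) : ℤ) =
        (inversionPoly s n ν).eval (-1) := by
      rw [Int.natCast_div, Nat.cast_prod]
      exact Int.ediv_eq_of_eq_mul_left hprod heval.symm
    rw [hdiv]
    constructor <;> linarith
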